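/- arXiv:2408.01756 — 2 statements merged into one kernel-verified Lean document; each statement's English description precedes it below -/
import Mathlib

section
/- Assume K > 0 is such that (∫_{ℝ^N} |v(x,0)|^{2*} dx)^{2/2*} ≤ K ∬_{ℝ^{N+1}_+} |∇v|² dx dy for every Schwartz function v : ℝ^{N+1} → ℝ. Then for every q ∈ [2, 2*] there exists a constant C > 0 such that (∫_{ℝ^N} |v(x,0)|^{q} dx)^{2/q} ≤ C ∬_{ℝ^{N+1}_+} (|∇v|² + |x|² v²) dx dy for every Schwartz function v : ℝ^{N+1} → ℝ. -/
open MeasureTheory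

noncomputable section

/-- `ℝ^N` as a Euclidean space. -/
abbrev RN (N : ℕ) := EuclideanSpace ℝ (Fin N)

/-- `ℝ^{N+1}`, with points written `(x, y)`, `x ∈ ℝ^N`, `y ∈ ℝ`. -/
abbrev RN1 (N : ℕ) := RN N × ℝ

/-- The upper half-space `{(x,y) : y > 0}`. -/
def upperHalf (N : ℕ) : Set (RN1 N) := {p | 0 < p.2}

/-- The `i`-th horizontal coordinate direction in `ℝ^{N+1}`. -/
def dirX (N : ℕ) (i : Fin N) : RN1 N := (EuclideanSpace.single i 1, 0)

/-- The vertical coordinate direction in `ℝ^{N+1}`. -/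
def dirY (N : ℕ) : RN1 N := (0, 1)

/-- `|∇v|²`, the squared norm of the full gradient of `v` at `p`. -/
def gradSq (N : ℕ) (v : RN1 N → ℝ) (p : RN1 N) : ℝ :=
  (∑ i : Fin N, (fderiv ℝ v p (dirX N i)) ^ 2) + (fderiv ℝ v p (dirY N)) ^ 2

/-- The critical exponent `2* = 2N/(N-1)`. -/
def twoStar (N : ℕ) : ℝ := 2 * N / (N - 1)

open Set Filter Topology
open scoped LineDeriv SchwartzMap

instance isAddHaarMeasure_volume_RN1 (N : ℕ) :
    (volume : Measure (RN1 N)).IsAddHaarMeasure :=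
  inferInstanceAs ((volume : Measure (RN N)).prod (volume : Measure ℝ)).IsAddHaarMeasure

/-- The squared norm of the gradient, plus the harmonic potential in `x`. -/
def oscEnergy (N : ℕ) (v : RN1 N → ℝ) (p : RN1 N) : ℝ :=
  gradSq N v p + ‖p.1‖ ^ 2 * (v p) ^ 2

/-- Lebesgue measure of the half-space, as a product measure. -/
def halfMeasure (N : ℕ) : Measure (RN1 N) :=
  (volume : Measure (RN N)).prod (volume.restrict (Ioi (0 : ℝ)))

lemma halfMeasure_eq (N : ℕ) : halfMeasure N = volume.restrict (upperHalf N) := by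
  have h : upperHalf N = (univ : Set (RN N)) ×ˢ Ioi (0 : ℝ) := by
    ext p; simp [upperHalf]
  rw [h, Measure.volume_eq_prod, ← Measure.prod_restrict, Measure.restrict_univ, halfMeasure]

lemma memLp_halfMeasure (N : ℕ) (v : 𝓢(RN1 N, ℝ)) : MemLp v 2 (halfMeasure N) := by
  rw [halfMeasure_eq]
  exact (v.memLp 2 volume).restrict _

lemma memLp_fderiv_halfMeasure (N : ℕ) (v : 𝓢(RN1 N, ℝ)) (d : RN1 N) :
    MemLp (fun p ↦ fderiv ℝ v p d) 2 (halfMeasure N) :=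
  memLp_halfMeasure N (∂_{d} v)

lemma integrable_normSq_mul_sq (N : ℕ) (v : 𝓢(RN1 N, ℝ)) :
    Integrable (fun p : RN1 N ↦ ‖p.1‖ ^ 2 * (v p) ^ 2) (halfMeasure N) := by
  rw [halfMeasure_eq]
  obtain ⟨C, -, hC⟩ := v.decay 0 0
  refine Integrable.restrict ?_
  refine ((v.integrable_pow_mul volume 2).mul_const C).mono'
    (by have := v.continuous; fun_prop) (.of_forall fun p ↦ ?_)
  have h1 : ‖v p‖ ≤ C := by simpa using hC p
  have h2 : ‖p.1‖ ≤ ‖p‖ := norm_fst_le p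
  have h3 : (v p) ^ 2 = ‖v p‖ * ‖v p‖ := by rw [Real.norm_eq_abs, abs_mul_abs_self, sq]
  rw [Real.norm_of_nonneg (by positivity), h3, mul_assoc]
  gcongr

lemma memLp_coord_mul (N : ℕ) (v : 𝓢(RN1 N, ℝ)) (i : Fin N) :
    MemLp (fun p : RN1 N ↦ p.1 i * v p) 2 (halfMeasure N) := by
  have hc := v.continuous
  have hm : AEStronglyMeasurable (fun p : RN1 N ↦ p.1 i * v p) (halfMeasure N) := by
    apply Continuous.aestronglyMeasurable
    fun_prop
  rw [memLp_two_iff_integrable_sq hm]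
  refine (integrable_normSq_mul_sq N v).mono' (hm.pow 2) (.of_forall fun p ↦ ?_)
  rw [Real.norm_of_nonneg (by positivity), mul_pow]
  refine mul_le_mul_of_nonneg_right ?_ (sq_nonneg _)
  rw [sq_le_sq, abs_norm]
  exact PiLp.norm_apply_le p.1 i

lemma integrable_oscEnergy (N : ℕ) (v : 𝓢(RN1 N, ℝ)) :
    Integrable (oscEnergy N v) (halfMeasure N) :=
  ((integrable_finsetSum _ fun i _ ↦ (memLp_fderiv_halfMeasure N v (dirX N i)).integrable_sq).add
    (memLp_fderiv_halfMeasure N v (dirY N)).integrable_sq).add (integrable_normSq_mul_sq N v)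

lemma coord_sq_add_deriv_sq_le_oscEnergy (N : ℕ) (v : RN1 N → ℝ) (i : Fin N) (p : RN1 N) :
    (p.1 i * v p) ^ 2 + (fderiv ℝ v p (dirX N i)) ^ 2 ≤ oscEnergy N v p := by
  have h1 : (fderiv ℝ v p (dirX N i)) ^ 2 ≤ ∑ j : Fin N, (fderiv ℝ v p (dirX N j)) ^ 2 :=
    Finset.single_le_sum (f := fun j ↦ (fderiv ℝ v p (dirX N j)) ^ 2)
      (fun j _ ↦ sq_nonneg _) (Finset.mem_univ i)
  have h2 : (p.1 i) ^ 2 ≤ ‖p.1‖ ^ 2 := by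
    rw [sq_le_sq, abs_norm]
    exact PiLp.norm_apply_le p.1 i
  have h3 := mul_le_mul_of_nonneg_right h2 (sq_nonneg (v p))
  rw [oscEnergy, gradSq, mul_pow]
  linarith [sq_nonneg (fderiv ℝ v p (dirY N))]

/-- Uncertainty-type inequality: the oscillator energy controls the `L²` norm. -/
lemma integral_sq_le_oscEnergy (N : ℕ) (i : Fin N) (v : 𝓢(RN1 N, ℝ)) :
    ∫ p, (v p) ^ 2 ∂halfMeasure N ≤ ∫ p, oscEnergy N v p ∂halfMeasure N := by
  have hv := memLp_halfMeasure N v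
  have hx := memLp_coord_mul N v i
  have hd := memLp_fderiv_halfMeasure N v (dirX N i)
  have I1 := hv.integrable_sq
  have I2 := hx.integrable_mul hv
  have I3 := hx.integrable_mul hd
  have I4 := hx.integrable_sq.add hd.integrable_sq
  refine le_trans ?_ (integral_mono I4 (integrable_oscEnergy N v)
    (coord_sq_add_deriv_sq_le_oscEnergy N v i))
  simp only [halfMeasure] at I1 I2 I3 I4 ⊢
  rw [integral_prod_symm _ I1, integral_prod_symm _ I4]
  refine integral_mono_ae I1.integral_prod_right I4.integral_prod_right ?_
  filter_upwards [I1.prod_left_ae, I2.prod_left_ae, I3.prod_left_ae, I4.prod_left_ae]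
    with y J1 J2 J3 J4
  simp only [Pi.mul_apply, Pi.add_apply] at J2 J3 J4 ⊢
  have parts := integral_bilinear_hasLineDerivAt_right_eq_neg_left_of_integrable
    (μ := (volume : Measure (RN N))) (f := fun x : RN N ↦ x i) (f' := fun _ ↦ (1 : ℝ))
    (g := fun x ↦ (v (x, y)) ^ 2) (g' := fun x ↦ 2 * v (x, y) * fderiv ℝ v (x, y) (dirX N i))
    (v := EuclideanSpace.single i 1) (B := ContinuousLinearMap.mul ℝ ℝ)
    (by simpa using J1)
    (by
      refine (J3.const_mul 2).congr (.of_forall fun x ↦ ?_)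
      simp only [ContinuousLinearMap.mul_apply']
      ring)
    (by
      refine J2.congr (.of_forall fun x ↦ ?_)
      simp only [ContinuousLinearMap.mul_apply']
      ring)
    (fun x _ ↦ by
      have := ((EuclideanSpace.proj i : RN N →L[ℝ] ℝ).hasFDerivAt (x := x)).hasLineDerivAt
        (EuclideanSpace.single i 1)
      simpa using this)
    (fun x _ ↦ by
      have h1 : HasFDerivAt (fun x : RN N ↦ (x, y)) (ContinuousLinearMap.inl ℝ (RN N) ℝ) x :=
        hasFDerivAt_prodMk_left x y
      have h2 := (((v.differentiable (x, y)).hasFDerivAt.comp x h1).pow 2).hasLineDerivAt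
        (EuclideanSpace.single i 1)
      refine h2.congr_deriv ?_
      simp [dirX])
  simp only [ContinuousLinearMap.mul_apply', one_mul] at parts
  have e : ∫ x : RN N, (v (x, y)) ^ 2
      = ∫ x : RN N, -(x i * (2 * v (x, y) * fderiv ℝ v (x, y) (dirX N i))) := by
    rw [integral_neg, parts, neg_neg]
  rw [e]
  refine integral_mono ((J3.const_mul 2).neg.congr (.of_forall fun x ↦ ?_)) J4 fun x ↦ ?_
  · simp only [Pi.neg_apply]
    ring
  · simp only
    nlinarith [sq_nonneg (x i * v (x, y) + fderiv ℝ v (x, y) (dirX N i))]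

/-- The trace of a Schwartz function, as a Schwartz function. -/
def schwartzTrace (N : ℕ) (v : 𝓢(RN1 N, ℝ)) : 𝓢(RN N, ℝ) :=
  SchwartzMap.compCLMOfAntilipschitz ℝ (K := 1) (g := fun x : RN N ↦ (x, (0 : ℝ)))
    (ContinuousLinearMap.inl ℝ (RN N) ℝ).hasTemperateGrowth
    (fun x y ↦ by simp [Prod.edist_eq]) v

lemma schwartzTrace_apply (N : ℕ) (v : 𝓢(RN1 N, ℝ)) (x : RN N) :
    schwartzTrace N v x = v (x, 0) := rfl

lemma integrable_trace_rpow (N : ℕ) (v : 𝓢(RN1 N, ℝ)) {q : ℝ} (hq : 0 < q) :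
    Integrable (fun x : RN N ↦ |v (x, 0)| ^ q) := by
  have := ((schwartzTrace N v).memLp (ENNReal.ofReal q)).integrable_norm_rpow
    (by simpa using hq) ENNReal.ofReal_ne_top
  simpa [ENNReal.toReal_ofReal hq.le, schwartzTrace_apply] using this

lemma integral_trace_sq_le (N : ℕ) (v : 𝓢(RN1 N, ℝ)) :
    ∫ x : RN N, (v (x, 0)) ^ 2 ≤
      ∫ p, ((v p) ^ 2 + (fderiv ℝ v p (dirY N)) ^ 2) ∂halfMeasure N := by
  have hv := memLp_halfMeasure N v
  have hd := memLp_fderiv_halfMeasure N v (dirY N)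
  have I1 := hv.integrable_sq
  have I2 := hv.integrable_mul hd
  have I3 := I1.add hd.integrable_sq
  have I0 : Integrable (fun x : RN N ↦ (v (x, 0)) ^ 2) :=
    ((schwartzTrace N v).memLp 2 volume).integrable_sq
  change _ ≤ ∫ p, ((fun p ↦ (v p) ^ 2) + fun p ↦ (fderiv ℝ v p (dirY N)) ^ 2) p ∂halfMeasure N
  simp only [halfMeasure] at I1 I2 I3 ⊢
  rw [integral_prod _ I3]
  refine integral_mono_ae I0 I3.integral_prod_left ?_
  filter_upwards [I1.prod_right_ae, I2.prod_right_ae, I3.prod_right_ae] with x J1 J2 J3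
  simp only [Pi.mul_apply, Pi.add_apply] at J2 J3 ⊢
  have hder (y : ℝ) : HasDerivAt (fun y ↦ (v (x, y)) ^ 2)
      (2 * (v (x, y) * fderiv ℝ v (x, y) (dirY N))) y := by
    have h1 : HasDerivAt (fun y : ℝ ↦ (x, y)) (dirY N) y :=
      (hasDerivAt_const y x).prodMk (hasDerivAt_id y)
    have h2 := ((v.differentiable (x, y)).hasFDerivAt.comp_hasDerivAt y h1).pow 2
    refine h2.congr_deriv ?_
    simp [mul_assoc]
  have J2' := J2.const_mul 2
  have ftc := integral_Ioi_of_hasDerivAt_of_tendsto' (a := 0) (fun y _ ↦ hder y) J2'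
    (tendsto_zero_of_hasDerivAt_of_integrableOn_Ioi (a := 0) (fun y _ ↦ hder y) J2' J1)
  have e : (v (x, 0)) ^ 2
      = ∫ y in Ioi (0 : ℝ), -(2 * (v (x, y) * fderiv ℝ v (x, y) (dirY N))) := by
    rw [integral_neg, ftc]
    ring
  rw [e]
  refine integral_mono J2'.neg J3 fun y ↦ ?_
  simp only
  nlinarith [sq_nonneg (v (x, y) + fderiv ℝ v (x, y) (dirY N))]

lemma gradSq_le_oscEnergy (N : ℕ) (v : RN1 N → ℝ) (p : RN1 N) :
    gradSq N v p ≤ oscEnergy N v p :=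
  le_add_of_nonneg_right (by positivity)

lemma gradSq_nonneg (N : ℕ) (v : RN1 N → ℝ) (p : RN1 N) : 0 ≤ gradSq N v p :=
  add_nonneg (Finset.sum_nonneg fun _ _ ↦ sq_nonneg _) (sq_nonneg _)

lemma oscEnergy_nonneg (N : ℕ) (v : RN1 N → ℝ) (p : RN1 N) : 0 ≤ oscEnergy N v p :=
  (gradSq_nonneg N v p).trans (gradSq_le_oscEnergy N v p)

/-- The trace inequality in `L²`. -/
lemma integral_trace_sq_le_oscEnergy (N : ℕ) (i : Fin N) (v : 𝓢(RN1 N, ℝ)) :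
    ∫ x : RN N, (v (x, 0)) ^ 2 ≤ 2 * ∫ p, oscEnergy N v p ∂halfMeasure N := by
  have hd := (memLp_fderiv_halfMeasure N v (dirY N)).integrable_sq
  have h1 := integral_trace_sq_le N v
  rw [integral_add (memLp_halfMeasure N v).integrable_sq hd] at h1
  have h2 := integral_sq_le_oscEnergy N i v
  have h3 : ∫ p, (fderiv ℝ v p (dirY N)) ^ 2 ∂halfMeasure N
      ≤ ∫ p, oscEnergy N v p ∂halfMeasure N := by
    refine integral_mono hd (integrable_oscEnergy N v) fun p ↦
      le_trans ?_ (gradSq_le_oscEnergy N v p)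
    exact le_add_of_nonneg_left (Finset.sum_nonneg fun _ _ ↦ sq_nonneg _)
  linarith

lemma rpow_le_add_rpow {t p q r : ℝ} (ht : 0 ≤ t) (hp : 0 < p) (hpq : p ≤ q) (hqr : q ≤ r) :
    t ^ q ≤ t ^ p + t ^ r := by
  rcases ht.eq_or_lt with rfl | ht
  · rw [Real.zero_rpow (by linarith), Real.zero_rpow (by linarith), Real.zero_rpow (by linarith)]
    simp
  rcases le_total t 1 with h | h
  · exact (Real.rpow_le_rpow_of_exponent_ge ht h hpq).trans (le_add_of_nonneg_right (by positivity))
  · exact (Real.rpow_le_rpow_of_exponent_le h hqr).trans (le_add_of_nonneg_left (by positivity))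

/-- Interpolation between `L²` and `L^r`, in a form adapted to energy bounds. -/
lemma integral_rpow_interpolate {α : Type*} [MeasurableSpace α] {μ : Measure α} {u : α → ℝ}
    {q r A B E : ℝ} (h2q : 2 ≤ q) (hqr : q ≤ r) (hB : 0 ≤ B) (hE : 0 < E)
    (i2 : Integrable (fun x ↦ |u x| ^ (2 : ℝ)) μ)
    (ir : Integrable (fun x ↦ |u x| ^ r) μ)
    (b2 : ∫ x, |u x| ^ (2 : ℝ) ∂μ ≤ A * E)
    (br : (∫ x, |u x| ^ r ∂μ) ^ (2 / r) ≤ B * E) :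
    (∫ x, |u x| ^ q ∂μ) ^ (2 / q) ≤ (A + B ^ (r / 2)) ^ (2 / q) * E := by
  have hq : 0 < q := by linarith
  have hr : 0 < r := by linarith
  set s := E ^ (1 / 2 : ℝ) with hs
  have hs0 : 0 < s := Real.rpow_pos_of_pos hE _
  have hsp (p : ℝ) : s ^ p = E ^ (p / 2) := by
    rw [hs, ← Real.rpow_mul hE.le]
    congr 1
    ring
  have hdiv (p : ℝ) (x : α) : (|u x| / s) ^ p = |u x| ^ p / E ^ (p / 2) := by
    rw [Real.div_rpow (abs_nonneg _) hs0.le, hsp]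
  have nn (p : ℝ) : 0 ≤ ∫ x, |u x| ^ p ∂μ := integral_nonneg fun x ↦ by positivity
  have br' : ∫ x, |u x| ^ r ∂μ ≤ B ^ (r / 2) * E ^ (r / 2) := by
    have := Real.rpow_le_rpow (Real.rpow_nonneg (nn r) _) br (by positivity : 0 ≤ r / 2)
    rw [← Real.rpow_mul (nn r), Real.mul_rpow hB hE.le,
      show 2 / r * (r / 2) = 1 by field_simp, Real.rpow_one] at this
    exact this
  have key : (∫ x, |u x| ^ q ∂μ) / E ^ (q / 2) ≤ A + B ^ (r / 2) := by
    calc (∫ x, |u x| ^ q ∂μ) / E ^ (q / 2) = ∫ x, |u x| ^ q / E ^ (q / 2) ∂μ :=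
          (integral_div _ _).symm
      _ ≤ ∫ x, (|u x| ^ (2 : ℝ) / E ^ ((2 : ℝ) / 2) + |u x| ^ r / E ^ (r / 2)) ∂μ := by
          refine integral_mono_of_nonneg (.of_forall fun x ↦ by positivity)
            ((i2.div_const _).add (ir.div_const _)) (.of_forall fun x ↦ ?_)
          simp only [← hdiv]
          exact rpow_le_add_rpow (by positivity) two_pos h2q hqr
      _ = (∫ x, |u x| ^ (2 : ℝ) ∂μ) / E + (∫ x, |u x| ^ r ∂μ) / E ^ (r / 2) := by
          rw [integral_add (i2.div_const _) (ir.div_const _), integral_div, integral_div,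
            div_self two_ne_zero, Real.rpow_one]
      _ ≤ A + B ^ (r / 2) := by
          gcongr
          · rwa [div_le_iff₀ hE]
          · rwa [div_le_iff₀ (by positivity)]
  have hAB : 0 ≤ A + B ^ (r / 2) := le_trans (div_nonneg (nn q) (by positivity)) key
  rw [div_le_iff₀ (by positivity)] at key
  calc (∫ x, |u x| ^ q ∂μ) ^ (2 / q)
      ≤ ((A + B ^ (r / 2)) * E ^ (q / 2)) ^ (2 / q) :=
        Real.rpow_le_rpow (nn q) key (by positivity)
    _ = (A + B ^ (r / 2)) ^ (2 / q) * E := by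
        rw [Real.mul_rpow hAB (by positivity), ← Real.rpow_mul hE.le,
          show q / 2 * (2 / q) = 1 by field_simp, Real.rpow_one]

theorem stmt1 (N : ℕ) (hN : 2 ≤ N) (K : ℝ) (hK : 0 < K)
    (hSob : ∀ v : SchwartzMap (RN1 N) ℝ,
      (∫ x : RN N, |v (x, 0)| ^ twoStar N) ^ (2 / twoStar N) ≤
        K * ∫ p in upperHalf N, gradSq N v p) :
    ∀ q : ℝ, q ∈ Set.Icc 2 (twoStar N) → ∃ C : ℝ, 0 < C ∧
      ∀ v : SchwartzMap (RN1 N) ℝ,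
        (∫ x : RN N, |v (x, 0)| ^ q) ^ (2 / q) ≤
          C * ∫ p in upperHalf N, (gradSq N v p + ‖p.1‖ ^ 2 * (v p) ^ 2) := by
  rintro q ⟨h2q, hqr⟩
  refine ⟨(2 + K ^ (twoStar N / 2)) ^ (2 / q), by positivity, fun v ↦ ?_⟩
  set M := ∫ p in upperHalf N, (gradSq N v p + ‖p.1‖ ^ 2 * (v p) ^ 2) with hM
  have hM' : M = ∫ p, oscEnergy N v p ∂halfMeasure N := by rw [halfMeasure_eq]; rfl
  have hM0 : 0 ≤ M := hM' ▸ integral_nonneg (oscEnergy_nonneg N v)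
  have hgrad : ∫ p in upperHalf N, gradSq N v p ≤ M := by
    rw [hM', ← halfMeasure_eq]
    exact integral_mono_of_nonneg (.of_forall (gradSq_nonneg N v)) (integrable_oscEnergy N v)
      (.of_forall (gradSq_le_oscEnergy N v))
  have h2 : ∫ x : RN N, |v (x, 0)| ^ (2 : ℝ) ≤ 2 * M := by
    have := integral_trace_sq_le_oscEnergy N ⟨0, by omega⟩ v
    simpa [hM'] using this
  have hE (E : ℝ) (hE : M < E) : (∫ x : RN N, |v (x, 0)| ^ q) ^ (2 / q)
      ≤ (2 + K ^ (twoStar N / 2)) ^ (2 / q) * E := by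
    refine integral_rpow_interpolate h2q hqr hK.le (hM0.trans_lt hE)
      (integrable_trace_rpow N v two_pos) (integrable_trace_rpow N v (by linarith))
      (h2.trans (by linarith)) ((hSob v).trans ?_)
    gcongr
    linarith
  have hlim : Tendsto (fun E ↦ (2 + K ^ (twoStar N / 2)) ^ (2 / q) * E) (𝓝[>] M)
      (𝓝 ((2 + K ^ (twoStar N / 2)) ^ (2 / q) * M)) :=
    (tendsto_id.const_mul _).mono_left nhdsWithin_le_nhds
  exact ge_of_tendsto hlim (eventually_mem_nhdsWithin.mono hE)
end
end

section
/- Let f : ℝ^N × ℝ → ℝ be C¹ and satisfy the growth bound |f(x,t)| ≤ a|t| + b|t|^{θ−1} for all (x,t), for some constants a, b > 0 and 2 < θ < 2*. Set F(x,s) = ∫₀^s f(x,t) dt. Let v : ℝ^{N+1} → ℝ be a Schwartz function such that −Δv(x,y) + |x|² v(x,y) = 0 for all (x,y) with y > 0 and −∂v/∂y(x,0) = f(x, v(x,0)) for all x ∈ ℝ^N, and assume that x ↦ F(x, v(x,0)) and x ↦ Σ_{i=1}^N x_i (∂F/∂x_i)(x, v(x,0)) are Lebesgue integrable on ℝ^N.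 Then the Pohozaev-type identity holds: ((N−1)/2) ∬_{ℝ^{N+1}_+} |∇v|² dx dy + ((N+3)/2) ∬_{ℝ^{N+1}_+} |x|² v² dx dy = N ∫_{ℝ^N} F(x, v(x,0)) dx + ∫_{ℝ^N} Σ_{i=1}^N x_i (∂F/∂x_i)(x, v(x,0)) dx. -/
open MeasureTheory

noncomputable section

/-- The Laplacian of `v` at `p` (sum of pure second derivatives). -/
def lap (N : ℕ) (v : RN1 N → ℝ) (p : RN1 N) : ℝ :=
  (∑ i : Fin N, fderiv ℝ (fun q => fderiv ℝ v q (dirX N i)) p (dirX N i)) +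
    fderiv ℝ (fun q => fderiv ℝ v q (dirY N)) p (dirY N)

section HalfSpace

open SchwartzMap Set Filter Topology
open scoped LineDeriv

variable {N : ℕ}

lemma antilipschitzWith_prodMk_const (y : ℝ) :
    AntilipschitzWith 1 (fun x : RN N => ((x, y) : RN1 N)) :=
  AntilipschitzWith.of_le_mul_dist fun x x' => by
    simp [Prod.dist_eq]

lemma hasTemperateGrowth_prodMk_const (y : ℝ) :
    (fun x : RN N => ((x, y) : RN1 N)).HasTemperateGrowth := by
  have h : (fun x : RN N => ((x, y) : RN1 N)) =
      (ContinuousLinearMap.inl ℝ (RN N) ℝ : RN N → RN1 N) + fun _ => ((0, y) : RN1 N) := by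
    ext x <;> simp
  rw [h]
  exact (ContinuousLinearMap.hasTemperateGrowth _).add (.const _)

/-- The restriction of a Schwartz function to a horizontal hyperplane. -/
def horizontalSlice (W : 𝓢(RN1 N, ℝ)) (y : ℝ) : 𝓢(RN N, ℝ) :=
  compCLMOfAntilipschitz ℝ (hasTemperateGrowth_prodMk_const y)
    (antilipschitzWith_prodMk_const y) W

lemma horizontalSlice_apply (W : 𝓢(RN1 N, ℝ)) (y : ℝ) (x : RN N) :
    horizontalSlice W y x = W (x, y) := rfl

lemma hasFDerivAt_horizontal (W : 𝓢(RN1 N, ℝ)) (y : ℝ) (x : RN N) :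
    HasFDerivAt (fun x' => W (x', y))
      ((fderiv ℝ W (x, y)).comp (ContinuousLinearMap.inl ℝ (RN N) ℝ)) x :=
  (W.hasFDerivAt (x, y)).comp x (hasFDerivAt_prodMk_left x y)

lemma integral_lineDerivOp_eq_zero (g : 𝓢(RN N, ℝ)) (m : RN N) : ∫ x, (∂_{m} g) x = 0 := by
  have h := integral_mul_fderiv_eq_neg_fderiv_mul_of_integrable (μ := volume)
    (f := fun _ : RN N => (1 : ℝ)) (g := g) (v := m)
    (by simp) (by simpa [lineDerivOp_apply_eq_fderiv] using (∂_{m} g).integrable)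
    (by simpa using g.integrable) (by simp) (fun x _ => g.differentiableAt)
  simpa [lineDerivOp_apply_eq_fderiv] using h

lemma upperHalf_eq_prod : upperHalf N = (univ : Set (RN N)) ×ˢ Ioi (0 : ℝ) := by
  ext p; simp [upperHalf]

lemma volume_restrict_upperHalf :
    (volume : Measure (RN1 N)).restrict (upperHalf N) =
      (volume : Measure (RN N)).prod (volume.restrict (Ioi (0 : ℝ))) := by
  rw [upperHalf_eq_prod, Measure.volume_eq_prod, ← Measure.prod_restrict, Measure.restrict_univ]

instance : (volume : Measure (RN1 N)).IsAddHaarMeasure := by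
  rw [Measure.volume_eq_prod]; infer_instance

lemma setIntegral_upperHalf_horizontal (W : 𝓢(RN1 N, ℝ)) (i : Fin N) :
    ∫ p in upperHalf N, (∂_{dirX N i} W) p = 0 := by
  have hint : Integrable (fun p => (∂_{dirX N i} W) p)
      ((volume : Measure (RN N)).prod (volume.restrict (Ioi (0 : ℝ)))) := by
    rw [← volume_restrict_upperHalf]
    exact (∂_{dirX N i} W).integrable.integrableOn
  rw [volume_restrict_upperHalf, integral_prod_symm _ hint]
  refine integral_eq_zero_of_ae (.of_forall fun y => ?_)
  have h := integral_lineDerivOp_eq_zero (horizontalSlice W y) (EuclideanSpace.single i 1)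
  rw [Pi.zero_apply, ← h]
  refine integral_congr_ae (.of_forall fun x => ?_)
  simp only [lineDerivOp_apply_eq_fderiv]
  have h2 : fderiv ℝ (horizontalSlice W y) x = _ := (hasFDerivAt_horizontal W y x).fderiv
  simp [h2, dirX]

lemma setIntegral_upperHalf_vertical (W : 𝓢(RN1 N, ℝ)) :
    ∫ p in upperHalf N, (∂_{dirY N} W) p = -∫ x : RN N, W (x, 0) := by
  have hint : Integrable (fun p => (∂_{dirY N} W) p)
      ((volume : Measure (RN N)).prod (volume.restrict (Ioi (0 : ℝ)))) := by
    rw [← volume_restrict_upperHalf]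
    exact (∂_{dirY N} W).integrable.integrableOn
  rw [volume_restrict_upperHalf, integral_prod _ hint, ← integral_neg]
  refine integral_congr_ae ?_
  filter_upwards [hint.prod_right_ae] with x hx
  have hd : ∀ y ∈ Ici (0 : ℝ), HasDerivAt (fun y' => W (x, y')) ((∂_{dirY N} W) (x, y)) y := by
    intro y _
    have h := ((W.hasFDerivAt (x, y)).comp y (hasFDerivAt_prodMk_right x y)).hasDerivAt
    simpa [lineDerivOp_apply_eq_fderiv, dirY, Function.comp_def] using h
  have ht : Tendsto (fun y => W (x, y)) atTop (𝓝 0) := by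
    refine W.tendsto_cocompact.comp ?_
    refine tendsto_cocompact_of_tendsto_dist_comp_atTop (0 : RN1 N) ?_
    refine tendsto_atTop_mono (fun y => ?_) tendsto_id
    rw [dist_zero_right]
    exact (le_abs_self y).trans (norm_snd_le ((x, y) : RN1 N))
  simpa using integral_Ioi_of_hasDerivAt_of_tendsto' hd hx ht

end HalfSpace

section Dilation

open Set Module

variable {E : Type*} [NormedAddCommGroup E] [NormedSpace ℝ E] [FiniteDimensional ℝ E]
  [MeasurableSpace E] [BorelSpace E] {μ : Measure E} [μ.IsAddHaarMeasure]

/-- The divergence theorem for the field `x ↦ g x • x` on the whole space, requiring integrability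
of `g` and of its radial derivative only. -/
lemma integral_fderiv_self_apply {g : E → ℝ} (hg : Differentiable ℝ g) (hgi : Integrable g μ)
    (hdi : Integrable (fun x => fderiv ℝ g x x) μ) :
    ∫ x, fderiv ℝ g x x ∂μ = -(finrank ℝ E * ∫ x, g x ∂μ) := by
  set n := finrank ℝ E with hn
  set H : E → ℝ := fun x => fderiv ℝ g x x with hH
  have hHm : Measurable H := by
    have h1 : Measurable (fun x => (fderiv ℝ g x, x)) := (measurable_fderiv ℝ g).prodMk measurable_id
    have h2 : Continuous (fun q : (E →L[ℝ] ℝ) × E => q.1 q.2) := by fun_prop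
    exact h2.measurable.comp h1
  set K : ℝ × E → ℝ := fun q => q.1⁻¹ * H (q.1 • q.2) with hK
  have hscale : ∀ (h : E → ℝ) (t : ℝ), t ∈ Ioc (1 : ℝ) 2 →
      ∫ x, h (t • x) ∂μ = (t ^ n)⁻¹ * ∫ x, h x ∂μ := fun h t ht => by
    rw [Measure.integral_comp_smul_of_nonneg μ h t (hR := by linarith [ht.1]), smul_eq_mul]
  have hpow : ContinuousOn (fun t : ℝ => t⁻¹ * (t ^ n)⁻¹) (uIcc 1 2) := by
    have hne : ∀ t ∈ uIcc (1 : ℝ) 2, t ≠ 0 := fun t ht => by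
      rw [uIcc_of_le one_le_two] at ht; linarith [ht.1]
    exact (continuousOn_inv₀.mono fun t ht => hne t ht).mul
      ((continuousOn_id.pow n).inv₀ fun t ht => pow_ne_zero _ (hne t ht))
  have hpowi (c : ℝ) : Integrable (fun t : ℝ => t⁻¹ * ((t ^ n)⁻¹ * c))
      (volume.restrict (Ioc 1 2)) := by
    have h := hpow.intervalIntegrable.mul_const (μ := volume) c
    rw [intervalIntegrable_iff_integrableOn_Ioc_of_le one_le_two] at h
    simpa only [mul_assoc, IntegrableOn] using h
  have hKi : Integrable K ((volume.restrict (Ioc (1 : ℝ) 2)).prod μ) := by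
    have hKm : Measurable K :=
      measurable_fst.inv.mul (hHm.comp (measurable_fst.smul measurable_snd))
    rw [integrable_prod_iff hKm.aestronglyMeasurable]
    constructor
    · refine (ae_restrict_mem measurableSet_Ioc).mono fun t ht => ?_
      have ht0 : t ≠ 0 := by linarith [ht.1]
      exact (hdi.comp_smul ht0).const_mul t⁻¹
    · refine (hpowi (∫ x, ‖H x‖ ∂μ)).congr ?_
      refine (ae_restrict_mem measurableSet_Ioc).mono fun t ht => ?_
      have ht0 : (0 : ℝ) < t := by linarith [ht.1]
      simp only [hK, norm_mul, integral_const_mul, norm_inv, Real.norm_of_nonneg ht0.le]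
      rw [hscale (fun x => ‖H x‖) t ht]
  have hdiff : ∀ᵐ x ∂μ, ∫ t in Ioc (1 : ℝ) 2, K (t, x) = g ((2 : ℝ) • x) - g x := by
    filter_upwards [hKi.prod_left_ae] with x hx
    have hd : ∀ t ∈ uIcc (1 : ℝ) 2, HasDerivAt (fun t => g (t • x)) (K (t, x)) t := by
      intro t ht
      rw [uIcc_of_le one_le_two] at ht
      have ht0 : t ≠ 0 := by linarith [ht.1]
      have h := (hg (t • x)).hasFDerivAt.comp_hasDerivAt t ((hasDerivAt_id t).smul_const x)
      refine h.congr_deriv ?_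
      simp [hK, hH, ht0]
    rw [← intervalIntegral.integral_of_le one_le_two,
      intervalIntegral.integral_eq_sub_of_hasDerivAt hd
        ((intervalIntegrable_iff_integrableOn_Ioc_of_le one_le_two).2 hx), one_smul]
  have hl : ∫ x, (∫ t in Ioc (1 : ℝ) 2, K (t, x)) ∂μ = ((2 ^ n)⁻¹ - 1) * ∫ x, g x ∂μ := by
    rw [integral_congr_ae hdiff, integral_sub (hgi.comp_smul two_ne_zero) hgi,
      hscale g 2 (by norm_num)]
    ring
  have hr : ∫ t in Ioc (1 : ℝ) 2, ∫ x, K (t, x) ∂μ =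
      (∫ t in (1 : ℝ)..2, t⁻¹ * (t ^ n)⁻¹) * ∫ x, H x ∂μ := by
    rw [intervalIntegral.integral_of_le one_le_two, ← integral_mul_const]
    refine setIntegral_congr_fun measurableSet_Ioc fun t ht => ?_
    change ∫ x, t⁻¹ * H (t • x) ∂μ = t⁻¹ * (t ^ n)⁻¹ * ∫ x, H x ∂μ
    rw [integral_const_mul, hscale H t ht, mul_assoc]
  have hprim : n * (∫ t in (1 : ℝ)..2, t⁻¹ * (t ^ n)⁻¹) = 1 - (2 ^ n)⁻¹ := by
    rw [← intervalIntegral.integral_const_mul]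
    have hd : ∀ t ∈ uIcc (1 : ℝ) 2,
        HasDerivAt (fun t : ℝ => -(t ^ n)⁻¹) (n * (t⁻¹ * (t ^ n)⁻¹)) t := by
      intro t ht
      rw [uIcc_of_le one_le_two] at ht
      have ht0 : t ≠ 0 := by linarith [ht.1]
      refine ((hasDerivAt_pow n t).fun_inv (pow_ne_zero n ht0)).fun_neg.congr_deriv ?_
      clear_value n
      rcases n with _ | k
      · simp
      · simp only [Nat.add_sub_cancel]
        field_simp
        ring
    rw [intervalIntegral.integral_eq_sub_of_hasDerivAt hd
      ((hpow.intervalIntegrable).const_mul _)]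
    simp; ring
  have hswap : ∫ t in Ioc (1 : ℝ) 2, ∫ x, K (t, x) ∂μ =
      ∫ x, (∫ t in Ioc (1 : ℝ) 2, K (t, x)) ∂μ :=
    integral_integral_swap (f := fun t x => K (t, x)) hKi
  rw [hr, hl] at hswap
  have hpos : 0 < ∫ t in (1 : ℝ)..2, t⁻¹ * (t ^ n)⁻¹ :=
    intervalIntegral.intervalIntegral_pos_of_pos_on hpow.intervalIntegrable
      (fun t ht => by have : (0 : ℝ) < t := by linarith [ht.1]
                      positivity) one_lt_two
  refine mul_left_cancel₀ hpos.ne' (hswap.trans ?_)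
  linear_combination (∫ x, g x ∂μ) * hprim

end Dilation

section Primitive

open Set Filter Topology Metric

variable {H : Type*} [NormedAddCommGroup H] [NormedSpace ℝ H] [FiniteDimensional ℝ H]

lemma differentiable_integral_of_contDiff {g : H → ℝ → ℝ}
    (hg : ContDiff ℝ 1 (Function.uncurry g)) :
    Differentiable ℝ (fun x => ∫ u in (0 : ℝ)..1, g x u) := by
  intro x₀
  have hc : Continuous (Function.uncurry g) := hg.continuous
  have hcf : Continuous (fun q : H × ℝ =>
      (fderiv ℝ (Function.uncurry g) q).comp (ContinuousLinearMap.inl ℝ H ℝ)) :=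
    (hg.continuous_fderiv one_ne_zero).clm_comp continuous_const
  have hK : IsCompact (closedBall x₀ 1 ×ˢ Icc (0 : ℝ) 1) :=
    (isCompact_closedBall x₀ 1).prod isCompact_Icc
  obtain ⟨C, hC⟩ := hK.exists_bound_of_continuousOn hcf.continuousOn
  refine (intervalIntegral.hasFDerivAt_integral_of_dominated_of_fderiv_le (𝕜 := ℝ)
    (F' := fun x u => (fderiv ℝ (Function.uncurry g) (x, u)).comp (ContinuousLinearMap.inl ℝ H ℝ))
    (bound := fun _ => C) (closedBall_mem_nhds x₀ one_pos) (.of_forall fun x => ?_) ?_ ?_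
    (.of_forall fun u hu x hx => hC (x, u) ⟨hx, ?_⟩) intervalIntegrable_const
    (.of_forall fun u _ x _ => ?_)).differentiableAt
  · exact (hc.comp (Continuous.prodMk_right x)).aestronglyMeasurable
  · exact (hc.comp (Continuous.prodMk_right x₀)).intervalIntegrable _ _
  · exact (hcf.comp (Continuous.prodMk_right x₀)).aestronglyMeasurable
  · rw [uIoc_of_le zero_le_one] at hu
    exact Ioc_subset_Icc_self hu
  · have hl : HasFDerivAt (fun x' : H => (x', u)) (ContinuousLinearMap.inl ℝ H ℝ) x :=
      hasFDerivAt_prodMk_left x u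
    exact ((hg.differentiable one_ne_zero) (x, u)).hasFDerivAt.comp x hl

lemma differentiable_primitive {f : H → ℝ → ℝ} (hf : ContDiff ℝ 1 (Function.uncurry f)) :
    Differentiable ℝ (fun p : H × ℝ => ∫ t in (0 : ℝ)..p.2, f p.1 t) := by
  have h : (fun p : H × ℝ => ∫ t in (0 : ℝ)..p.2, f p.1 t) =
      fun p => p.2 * ∫ u in (0 : ℝ)..1, f p.1 (p.2 * u) := by
    ext p
    rw [intervalIntegral.mul_integral_comp_mul_left]
    simp
  rw [h]
  refine differentiable_snd.mul
    (differentiable_integral_of_contDiff (g := fun p : H × ℝ => fun u => f p.1 (p.2 * u)) ?_)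
  exact hf.comp (g := Function.uncurry f)
    (f := fun q : (H × ℝ) × ℝ => (q.1.1, q.1.2 * q.2)) (by fun_prop)

lemma fderiv_primitive_comp {f : H → ℝ → ℝ} (hf : ContDiff ℝ 1 (Function.uncurry f))
    {u : H → ℝ} (hu : Differentiable ℝ u) (x m : H) :
    DifferentiableAt ℝ (fun x' => ∫ t in (0 : ℝ)..u x', f x' t) x ∧
    fderiv ℝ (fun x' => ∫ t in (0 : ℝ)..u x', f x' t) x m =
      fderiv ℝ (fun x' => ∫ t in (0 : ℝ)..u x, f x' t) x m + f x (u x) * fderiv ℝ u x m := by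
  set Φ : H × ℝ → ℝ := fun p => ∫ t in (0 : ℝ)..p.2, f p.1 t with hΦ
  have hd : HasFDerivAt Φ _ (x, u x) := (differentiable_primitive hf (x, u x)).hasFDerivAt
  have h1 : HasFDerivAt (fun x' => Φ (x', u x')) _ x :=
    HasFDerivAt.comp (f := fun x' => (x', u x')) x hd
      ((hasFDerivAt_id x).prodMk (hu x).hasFDerivAt)
  have hl : HasFDerivAt (fun x' : H => (x', u x)) (ContinuousLinearMap.inl ℝ H ℝ) x :=
    hasFDerivAt_prodMk_left x (u x)
  have h2 : HasFDerivAt (fun x' => Φ (x', u x)) _ x :=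
    HasFDerivAt.comp (f := fun x' => (x', u x)) x hd hl
  have h3 : HasDerivAt (fun s => Φ (x, s)) _ (u x) :=
    (HasFDerivAt.comp (u x) hd (hasFDerivAt_prodMk_right x (u x))).hasDerivAt
  have hcont : Continuous (f x) := hf.continuous.comp (Continuous.prodMk_right x)
  have h4 : HasDerivAt (fun s => Φ (x, s)) (f x (u x)) (u x) :=
    intervalIntegral.integral_hasDerivAt_right (hcont.intervalIntegrable _ _)
      (hcont.stronglyMeasurableAtFilter _ _) hcont.continuousAt
  have h5 := h3.unique h4
  refine ⟨h1.differentiableAt, ?_⟩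
  rw [h1.fderiv, h2.fderiv, ← h5]
  set L := fderiv ℝ Φ (x, u x)
  have h6 : (m, fderiv ℝ u x m) = ((m, 0) : H × ℝ) + fderiv ℝ u x m • ((0, 1) : H × ℝ) := by
    simp
  simp only [ContinuousLinearMap.comp_apply, ContinuousLinearMap.prod_apply,
    ContinuousLinearMap.id_apply, ContinuousLinearMap.inl_apply, ContinuousLinearMap.inr_apply]
  rw [h6, map_add, map_smul, smul_eq_mul, mul_comm]

end Primitive

section PointwiseIdentity

open SchwartzMap LineDeriv

variable {E ι : Type*} [NormedAddCommGroup E] [NormedSpace ℝ E] [Fintype ι]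

lemma lineDerivOp_lineDerivOp_comm (v : 𝓢(E, ℝ)) (m m' : E) (p : E) :
    (∂_{m} (∂_{m'} v)) p = (∂_{m'} (∂_{m} v)) p := by
  have hsymm : IsSymmSndFDerivAt ℝ v p :=
    (v.smooth 2).contDiffAt.isSymmSndFDerivAt (by simp)
  have hd : DifferentiableAt ℝ (fderiv ℝ v) p :=
    ((v.smooth 2).fderiv_right (m := 1) (by norm_num)).differentiable one_ne_zero p
  have key (a b : E) : (∂_{a} (∂_{b} v)) p = fderiv ℝ (fderiv ℝ v) p a b := by
    rw [lineDerivOp_apply_eq_fderiv]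
    have h : ((∂_{b} v : 𝓢(E, ℝ)) : E → ℝ) = fun q => fderiv ℝ v q b :=
      funext fun q => lineDerivOp_apply_eq_fderiv b v q
    rw [h, fderiv_clm_apply hd (differentiableAt_const b)]
    simp
  rw [key, key, hsymm.eq]

/-- The derivative of `v` in the direction of the position vector, in the coordinates `z`
dual to the frame `e`. -/
def eulerDeriv (e : ι → E) (z : ι → E →L[ℝ] ℝ) (v : 𝓢(E, ℝ)) : 𝓢(E, ℝ) :=
  ∑ i, smulLeftCLM ℝ (z i) (∂_{e i} v)

/-- The energy density `(|∇v|² + q v²) / 2`. -/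
def energyDensity (e : ι → E) (q : E → ℝ) (v : 𝓢(E, ℝ)) : 𝓢(E, ℝ) :=
  (1 / 2 : ℝ) • (∑ i, smulLeftCLM ℝ (⇑(∂_{e i} v : 𝓢(E, ℝ))) (∂_{e i} v) + smulLeftCLM ℝ q (smulLeftCLM ℝ v v))

/-- The Pohozaev field `(z · ∇v) ∇v - ((|∇v|² + q v²) / 2) z`. -/
def pohozaevField (e : ι → E) (z : ι → E →L[ℝ] ℝ) (q : E → ℝ) (v : 𝓢(E, ℝ)) (j : ι) : 𝓢(E, ℝ) :=
  smulLeftCLM ℝ (⇑(∂_{e j} v : 𝓢(E, ℝ))) (eulerDeriv e z v) - smulLeftCLM ℝ (z j) (energyDensity e q v)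

variable {e : ι → E} {z : ι → E →L[ℝ] ℝ} {c : ι → ℝ} {q : E → ℝ} (v : 𝓢(E, ℝ))

lemma lineDerivOp_smulLeftCLM_apply {g : E → ℝ} (hg : g.HasTemperateGrowth) (u : 𝓢(E, ℝ)) (p m : E) :
    (∂_{m} (smulLeftCLM ℝ g u)) p = fderiv ℝ g p m * u p + g p * (∂_{m} u) p := by
  rw [lineDerivOp_apply_eq_fderiv, lineDerivOp_apply_eq_fderiv, smulLeftCLM_apply hg]
  have hgd : DifferentiableAt ℝ g p := hg.1.differentiable (by simp) p
  simp only [smul_eq_mul]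
  rw [fderiv_fun_mul hgd u.differentiableAt]
  simp; ring

lemma eulerDeriv_apply (p : E) :
    eulerDeriv e z v p = ∑ i, z i p * (∂_{e i} v) p := by
  simp [eulerDeriv, sum_apply, smulLeftCLM_apply_apply (ContinuousLinearMap.hasTemperateGrowth _)]

lemma energyDensity_apply (hq : q.HasTemperateGrowth) (p : E) :
    energyDensity e q v p = (∑ i, (∂_{e i} v) p ^ 2 + q p * v p ^ 2) / 2 := by
  simp [energyDensity, sum_apply, smulLeftCLM_apply_apply (SchwartzMap.hasTemperateGrowth _),
    smulLeftCLM_apply_apply hq]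
  ring_nf

lemma pohozaevField_apply (hq : q.HasTemperateGrowth) (j : ι) (p : E) :
    pohozaevField e z q v j p = (∂_{e j} v) p * (∑ i, z i p * (∂_{e i} v) p) -
      z j p * ((∑ i, (∂_{e i} v) p ^ 2 + q p * v p ^ 2) / 2) := by
  simp [pohozaevField, smulLeftCLM_apply_apply (SchwartzMap.hasTemperateGrowth _),
    smulLeftCLM_apply_apply (ContinuousLinearMap.hasTemperateGrowth _),
    energyDensity_apply v hq, eulerDeriv_apply]

lemma lineDerivOp_eulerDeriv [DecidableEq ι] (hz : ∀ i j, z i (e j) = if i = j then 1 else 0) (j : ι) (p : E) :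
    (∂_{e j} (eulerDeriv e z v)) p =
      (∂_{e j} v) p + ∑ i, z i p * (∂_{e j} (∂_{e i} v)) p := by
  simp [eulerDeriv, lineDerivOp_sum, sum_apply,
    lineDerivOp_smulLeftCLM_apply (ContinuousLinearMap.hasTemperateGrowth _), hz, Finset.sum_add_distrib]

lemma lineDerivOp_energyDensity (hq : q.HasTemperateGrowth) (j : ι) (p : E) :
    (∂_{e j} (energyDensity e q v)) p =
      ∑ i, (∂_{e i} v) p * (∂_{e j} (∂_{e i} v)) p + fderiv ℝ q p (e j) * v p ^ 2 / 2 +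
        q p * v p * (∂_{e j} v) p := by
  simp only [energyDensity, lineDerivOp_smul, lineDerivOp_add, lineDerivOp_sum, sum_apply,
    smul_apply, add_apply, lineDerivOp_smulLeftCLM_apply (SchwartzMap.hasTemperateGrowth _),
    lineDerivOp_smulLeftCLM_apply hq, smulLeftCLM_apply_apply (SchwartzMap.hasTemperateGrowth _),
    smul_eq_mul, ← lineDerivOp_apply_eq_fderiv]
  have : ∑ i, ((∂_{e j} (∂_{e i} v)) p * (∂_{e i} v) p + (∂_{e i} v) p * (∂_{e j} (∂_{e i} v)) p) =
      2 * ∑ i, (∂_{e i} v) p * (∂_{e j} (∂_{e i} v)) p := by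
    rw [Finset.mul_sum]; exact Finset.sum_congr rfl fun i _ => by ring
  rw [this]; ring

/-- The divergence of the Pohozaev field, for a quadratic potential `q = ∑ c i (z i)²`. -/
lemma divergence_pohozaevField [DecidableEq ι] (hz : ∀ i j, z i (e j) = if i = j then 1 else 0)
    (hq : q.HasTemperateGrowth) (hqd : ∀ p j, fderiv ℝ q p (e j) = 2 * c j * z j p)
    (hqz : ∀ p, q p = ∑ i, c i * z i p ^ 2) (p : E)
    (hpde : ∑ j, (∂_{e j} (∂_{e j} v)) p = q p * v p) :
    ∑ j, (∂_{e j} (pohozaevField e z q v j)) p =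
      -((Fintype.card ι - 2) / 2 * ∑ i, (∂_{e i} v) p ^ 2 +
        (Fintype.card ι + 2) / 2 * (q p * v p ^ 2)) := by
  set P := ∑ i, z i p * (∂_{e i} v) p with hP
  set g := (∑ i, (∂_{e i} v) p ^ 2 + q p * v p ^ 2) / 2 with hg
  set T := ∑ j, ∑ i, (∂_{e j} v) p * (z i p * (∂_{e j} (∂_{e i} v)) p) with hT
  have hterm (j : ι) : (∂_{e j} (pohozaevField e z q v j)) p =
      (∂_{e j} (∂_{e j} v)) p * P + (∂_{e j} v) p ^ 2 +
        (∑ i, (∂_{e j} v) p * (z i p * (∂_{e j} (∂_{e i} v)) p)) - g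
        - (∑ i, (∂_{e i} v) p * (z j p * (∂_{e i} (∂_{e j} v)) p))
        - v p ^ 2 * (c j * z j p ^ 2) - q p * v p * (z j p * (∂_{e j} v) p) := by
    have h1 : ∑ i, (∂_{e i} v) p * (z j p * (∂_{e i} (∂_{e j} v)) p) =
        z j p * ∑ i, (∂_{e i} v) p * (∂_{e j} (∂_{e i} v)) p := by
      rw [Finset.mul_sum]
      refine Finset.sum_congr rfl fun i _ => ?_
      rw [lineDerivOp_lineDerivOp_comm v (e i) (e j)]; ring
    rw [h1, ← Finset.mul_sum]
    have hsub (a b : 𝓢(E, ℝ)) : ∂_{e j} (a - b) = ∂_{e j} a - ∂_{e j} b :=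
      map_sub (lineDerivOpCLM ℝ 𝓢(E, ℝ) (e j)) a b
    simp only [pohozaevField, hsub, sub_apply,
      lineDerivOp_smulLeftCLM_apply (SchwartzMap.hasTemperateGrowth _),
      lineDerivOp_smulLeftCLM_apply (ContinuousLinearMap.hasTemperateGrowth _),
      lineDerivOp_eulerDeriv v hz, lineDerivOp_energyDensity v hq, hqd,
      ContinuousLinearMap.fderiv, hz, energyDensity_apply v hq, eulerDeriv_apply,
      ← lineDerivOp_apply_eq_fderiv]
    rw [← hP, ← hg]
    simp only [if_true]
    ring
  have hswap : ∑ j, ∑ i, (∂_{e i} v) p * (z j p * (∂_{e i} (∂_{e j} v)) p) = T :=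
    Finset.sum_comm
  have hmul : ∑ j, (∂_{e j} v) p * ∑ i, z i p * (∂_{e j} (∂_{e i} v)) p = T := by
    simp only [hT, Finset.mul_sum]
  simp only [hterm, Finset.sum_sub_distrib, Finset.sum_add_distrib, ← Finset.mul_sum,
    ← Finset.sum_mul, hswap, hmul, hpde, ← hqz, ← hP, Finset.sum_const, Finset.card_univ, nsmul_eq_mul]
  linear_combination -(Fintype.card ι : ℝ) * hg

end PointwiseIdentity

section HalfSpaceIdentity

open SchwartzMap LineDeriv

variable {N : ℕ}

/-- The standard frame of `ℝ^{N+1}`, the vertical direction being indexed by `none`. -/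
def stdFrame (N : ℕ) : Option (Fin N) → RN1 N
  | none => dirY N
  | some i => dirX N i

/-- The coordinates dual to `stdFrame`. -/
def stdCoord (N : ℕ) : Option (Fin N) → RN1 N →L[ℝ] ℝ
  | none => ContinuousLinearMap.snd ℝ (RN N) ℝ
  | some i => (EuclideanSpace.proj i).comp (ContinuousLinearMap.fst ℝ (RN N) ℝ)

lemma stdCoord_stdFrame (i j : Option (Fin N)) :
    stdCoord N i (stdFrame N j) = if i = j then 1 else 0 := by
  rcases i with _ | i <;> rcases j with _ | j <;>
    simp [stdCoord, stdFrame, dirX, dirY]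

lemma hasTemperateGrowth_norm_fst_sq :
    (fun p : RN1 N => ‖p.1‖ ^ 2).HasTemperateGrowth :=
  (Function.hasTemperateGrowth_norm_sq (RN N)).comp (ContinuousLinearMap.fst ℝ (RN N) ℝ).hasTemperateGrowth

lemma fderiv_norm_fst_sq (p : RN1 N) (j : Option (Fin N)) :
    fderiv ℝ (fun p : RN1 N => ‖p.1‖ ^ 2) p (stdFrame N j) =
      2 * (if j = none then 0 else 1) * stdCoord N j p := by
  have h : HasFDerivAt (fun p : RN1 N => ‖p.1‖ ^ 2) _ p := hasFDerivAt_fst.norm_sq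
  rw [h.fderiv]
  rcases j with _ | j <;> simp [stdCoord, stdFrame, dirX, dirY, EuclideanSpace.inner_single_right]

lemma norm_fst_sq_eq_sum (p : RN1 N) :
    ‖p.1‖ ^ 2 = ∑ j, (if j = none then 0 else 1) * stdCoord N j p ^ 2 := by
  simp [EuclideanSpace.norm_sq_eq, Fintype.sum_option, stdCoord]

lemma gradSq_eq_sum (v : 𝓢(RN1 N, ℝ)) (p : RN1 N) :
    gradSq N v p = ∑ j, (∂_{stdFrame N j} v) p ^ 2 := by
  simp [gradSq, Fintype.sum_option, stdFrame, lineDerivOp_apply_eq_fderiv, add_comm]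

lemma lap_eq_sum (v : 𝓢(RN1 N, ℝ)) (p : RN1 N) :
    lap N v p = ∑ j, (∂_{stdFrame N j} (∂_{stdFrame N j} v)) p := by
  have h (m : RN1 N) : (∂_{m} (∂_{m} v)) p = fderiv ℝ (fun q => fderiv ℝ v q m) p m := by
    rw [lineDerivOp_apply_eq_fderiv]
    rfl
  simp [lap, Fintype.sum_option, stdFrame, h, add_comm]

lemma integrable_gradSq (v : 𝓢(RN1 N, ℝ)) : Integrable (gradSq N v) := by
  have h : gradSq N v = fun p => ∑ j,
      smulLeftCLM ℝ (⇑(∂_{stdFrame N j} v : 𝓢(RN1 N, ℝ))) (∂_{stdFrame N j} v) p := by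
    ext p
    simp [gradSq_eq_sum, smulLeftCLM_apply_apply (SchwartzMap.hasTemperateGrowth _), sq]
  rw [h]
  exact integrable_finsetSum _ fun j _ => SchwartzMap.integrable _

lemma integrable_norm_fst_sq_mul_sq (v : 𝓢(RN1 N, ℝ)) :
    Integrable (fun p : RN1 N => ‖p.1‖ ^ 2 * v p ^ 2) := by
  refine (smulLeftCLM ℝ (fun p : RN1 N => ‖p.1‖ ^ 2) (smulLeftCLM ℝ v v)).integrable.congr
    (.of_forall fun p => ?_)
  simp only [smulLeftCLM_apply_apply (SchwartzMap.hasTemperateGrowth _),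
    smulLeftCLM_apply_apply hasTemperateGrowth_norm_fst_sq, sq (v p), smul_eq_mul]

lemma eulerDeriv_std_boundary (v : 𝓢(RN1 N, ℝ)) (x : RN N) :
    eulerDeriv (stdFrame N) (stdCoord N) v (x, 0) =
      ∑ i, x i * fderiv ℝ v (x, 0) (dirX N i) := by
  simp [eulerDeriv_apply, Fintype.sum_option, stdFrame, stdCoord, lineDerivOp_apply_eq_fderiv]

/-- The Pohozaev identity in the half-space for solutions of `Δv = |x|² v`, with the normal
derivative of `v` in the boundary term. -/
lemma pohozaev_upperHalf (v : 𝓢(RN1 N, ℝ))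
    (hpde : ∀ p ∈ upperHalf N, lap N v p = ‖p.1‖ ^ 2 * v p) :
    ((N : ℝ) - 1) / 2 * (∫ p in upperHalf N, gradSq N v p) +
      ((N : ℝ) + 3) / 2 * (∫ p in upperHalf N, ‖p.1‖ ^ 2 * (v p) ^ 2) =
      ∫ x : RN N, fderiv ℝ v (x, 0) (dirY N) * ∑ i, x i * fderiv ℝ v (x, 0) (dirX N i) := by
  set q : RN1 N → ℝ := fun p => ‖p.1‖ ^ 2 with hq
  set W := pohozaevField (stdFrame N) (stdCoord N) q v with hW
  have hm : MeasurableSet (upperHalf N) := measurableSet_lt measurable_const measurable_snd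
  have hdiv : ∫ p in upperHalf N, ∑ j, (∂_{stdFrame N j} (W j)) p =
      -∫ x : RN N, W none (x, 0) := by
    rw [integral_finsetSum _ fun j _ => (∂_{stdFrame N j} (W j)).integrable.integrableOn,
      Fintype.sum_option]
    simp only [stdFrame, setIntegral_upperHalf_vertical, setIntegral_upperHalf_horizontal,
      Finset.sum_const_zero, add_zero]
  have hbd (x : RN N) : W none (x, 0) =
      fderiv ℝ v (x, 0) (dirY N) * ∑ i, x i * fderiv ℝ v (x, 0) (dirX N i) := by
    rw [hW, pohozaevField_apply v hasTemperateGrowth_norm_fst_sq, ← eulerDeriv_apply,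
      eulerDeriv_std_boundary]
    simp [stdCoord, stdFrame, lineDerivOp_apply_eq_fderiv]
  have hpt : ∀ p ∈ upperHalf N, ∑ j, (∂_{stdFrame N j} (W j)) p =
      -(((N : ℝ) - 1) / 2 * gradSq N v p + ((N : ℝ) + 3) / 2 * (‖p.1‖ ^ 2 * v p ^ 2)) := by
    intro p hp
    rw [hW, divergence_pohozaevField v stdCoord_stdFrame hasTemperateGrowth_norm_fst_sq
      fderiv_norm_fst_sq norm_fst_sq_eq_sum p (by rw [← lap_eq_sum, hpde p hp]), gradSq_eq_sum]
    simp only [Fintype.card_option, Fintype.card_fin, Nat.cast_add, Nat.cast_one]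
    ring
  rw [setIntegral_congr_fun hm hpt, integral_neg, neg_inj, integral_add
    ((integrable_gradSq v).integrableOn.const_mul _)
    ((integrable_norm_fst_sq_mul_sq v).integrableOn.const_mul _), integral_const_mul,
    integral_const_mul] at hdiv
  simpa only [hbd] using hdiv

lemma integrable_normalDeriv_mul_radialDeriv (v : 𝓢(RN1 N, ℝ)) :
    Integrable fun x : RN N =>
      fderiv ℝ v (x, 0) (dirY N) * ∑ i, x i * fderiv ℝ v (x, 0) (dirX N i) := by
  refine (horizontalSlice (smulLeftCLM ℝ (⇑(∂_{dirY N} v : 𝓢(RN1 N, ℝ)))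
    (eulerDeriv (stdFrame N) (stdCoord N) v)) 0).integrable.congr (.of_forall fun x => ?_)
  simp only [horizontalSlice_apply]
  rw [smulLeftCLM_apply_apply (SchwartzMap.hasTemperateGrowth _), eulerDeriv_std_boundary,
    lineDerivOp_apply_eq_fderiv, smul_eq_mul]

end HalfSpaceIdentity

theorem stmt7 (N : ℕ) (hN : 2 ≤ N) (f : RN N → ℝ → ℝ)
    (hf : ContDiff ℝ 1 (Function.uncurry f))
    (a b θ : ℝ) (ha : 0 < a) (hb : 0 < b) (hθ : 2 < θ) (hθ' : θ < twoStar N)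
    (hgrowth : ∀ x t, |f x t| ≤ a * |t| + b * |t| ^ (θ - 1))
    (F : RN N → ℝ → ℝ) (hF : ∀ x s, F x s = ∫ t in (0:ℝ)..s, f x t)
    (v : SchwartzMap (RN1 N) ℝ)
    (hpde : ∀ p : RN1 N, 0 < p.2 → -lap N v p + ‖p.1‖ ^ 2 * v p = 0)
    (hbdry : ∀ x : RN N, -(fderiv ℝ (v : RN1 N → ℝ) (x, 0) (dirY N)) = f x (v (x, 0)))
    (hFint : Integrable (fun x : RN N => F x (v (x, 0))) volume)
    (hFxint : Integrable (fun x : RN N =>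
      ∑ i : Fin N,
        x i * fderiv ℝ (fun x' : RN N => F x' (v (x, 0))) x (EuclideanSpace.single i 1)) volume) :
    ((N : ℝ) - 1) / 2 * (∫ p in upperHalf N, gradSq N v p) +
      ((N : ℝ) + 3) / 2 * (∫ p in upperHalf N, ‖p.1‖ ^ 2 * (v p) ^ 2) =
      (N : ℝ) * (∫ x : RN N, F x (v (x, 0))) +
        ∫ x : RN N,
          ∑ i : Fin N,
            x i * fderiv ℝ (fun x' : RN N => F x' (v (x, 0))) x (EuclideanSpace.single i 1) := by
  have hu : Differentiable ℝ fun x : RN N => v (x, 0) := (horizontalSlice v 0).differentiable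
  simp only [hF] at hFint hFxint ⊢
  set G : RN N → ℝ := fun x => ∫ t in (0 : ℝ)..v (x, 0), f x t with hG
  set R : RN N → ℝ := fun x =>
    fderiv ℝ v (x, 0) (dirY N) * ∑ i, x i * fderiv ℝ v (x, 0) (dirX N i) with hR
  have hRi : Integrable R := integrable_normalDeriv_mul_radialDeriv v
  have hdir (x : RN N) (i : Fin N) :
      fderiv ℝ (fun x' : RN N => v (x', 0)) x (EuclideanSpace.single i 1) =
        fderiv ℝ v (x, 0) (dirX N i) := by
    simp [(hasFDerivAt_horizontal v 0 x).fderiv, dirX]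
  have hrad (x : RN N) : fderiv ℝ G x x =
      (∑ i, x i * fderiv ℝ (fun x' : RN N => ∫ t in (0 : ℝ)..v (x, 0), f x' t) x
        (EuclideanSpace.single i 1)) - R x := by
    have hx : x = ∑ i, x i • EuclideanSpace.single i (1 : ℝ) := by
      simpa using ((EuclideanSpace.basisFun (Fin N) ℝ).sum_repr x).symm
    conv_lhs => rw [hx, map_sum, ← hx]
    simp only [hR]
    rw [Finset.mul_sum, ← Finset.sum_sub_distrib]
    refine Finset.sum_congr rfl fun i _ => ?_
    rw [map_smul, hG, (fderiv_primitive_comp hf hu x _).2, hdir, ← hbdry, smul_eq_mul]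
    ring
  have key := integral_fderiv_self_apply (g := G) (μ := volume)
    (fun x => (fderiv_primitive_comp hf hu x 0).1) hFint
    ((hFxint.sub hRi).congr (.of_forall fun x => (hrad x).symm))
  simp only [hrad] at key
  rw [pohozaev_upperHalf v fun p hp => by linarith [hpde p hp]]
  rw [integral_sub hFxint hRi, finrank_euclideanSpace_fin] at key
  linear_combination -key
end
end
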